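/- Let G be an n×n real symmetric positive definite matrix with smallest eigenvalue λ_min > 0, largest eigenvalue λ_max, and condition number κ = λ_max/λ_min. Let α > 0 be a non-integer real with α ≠ 1, let ε ∈ (0,1/3), δ ∈ (0,1), set s = ⌈8·ln(2/δ)/ε²⌉, and let m be an integer with m ≥ α + √κ·(Γ(α+1/2)·Γ(α)/(ε·π^{3/2}))^{1/(2α)}. Let g₁,…,g_s be i.i.d. standard Gaussian vectors in ℝⁿ and define the Chebyshev estimator S̃_α(G) = (1/(1−α))·log₂((1/s)·Σ_{i=1}^s gᵢᵀ f_m(G) gᵢ), where f_m(G) = (c₀/2)·I + Σ_{k=1}^m c_k·T_k(2G/λ_max − I). Then with probability at least 1−δ one has |S_α(G) − S̃_α(G)| ≤ |(1/(1−α))·log₂(1−3ε)|. -/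

import Mathlib

open MeasureTheory ProbabilityTheory Matrix

/-- Joint law of `s` i.i.d. standard Gaussian vectors in `ℝⁿ`
(each vector has `n` i.i.d. standard normal coordinates). -/
noncomputable def gaussianVecs (s n : ℕ) : Measure (Fin s → Fin n → ℝ) :=
  Measure.pi fun _ => Measure.pi fun _ => gaussianReal 0 1

/-- Chebyshev coefficients of `x^α` on `[0, λ_max]`:
`c_k = 2·λ_max^α·Γ(α+1/2)·Γ(α+1)/(√π·Γ(α−k+1)·Γ(α+k+1))`. -/
noncomputable def chebCoeff (α lmax : ℝ) (k : ℕ) : ℝ :=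
  2 * lmax ^ α * Real.Gamma (α + 1 / 2) * Real.Gamma (α + 1) /
    (Real.sqrt Real.pi * Real.Gamma (α - k + 1) * Real.Gamma (α + k + 1))

/-- Degree-`m` Chebyshev approximant of the matrix power `G^α` on `[0, λ_max]`:
`f_m(G) = (c₀/2)·I + Σ_{k=1}^m c_k·T_k(2G/λ_max − I)`. -/
noncomputable def chebApproxMatrix {n : ℕ} (α lmax : ℝ) (m : ℕ)
    (G : Matrix (Fin n) (Fin n) ℝ) : Matrix (Fin n) (Fin n) ℝ :=
  (chebCoeff α lmax 0 / 2) • (1 : Matrix (Fin n) (Fin n) ℝ) +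
    ∑ k ∈ Finset.Icc 1 m, chebCoeff α lmax k •
      Polynomial.aeval ((2 / lmax) • G - 1) (Polynomial.Chebyshev.T ℝ (k : ℤ))


/-- The cosine moment `∫₀^π |cos (θ/2)|^{2α} cos (kθ) dθ`. -/
noncomputable def cosMoment (α : ℝ) (k : ℕ) : ℝ :=
  ∫ θ in (0 : ℝ)..Real.pi, |Real.cos (θ / 2)| ^ (2 * α) * Real.cos (k * θ)

lemma continuous_abs_cos_half_rpow {p : ℝ} (hp : 0 ≤ p) :
    Continuous fun θ : ℝ => |Real.cos (θ / 2)| ^ p :=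
  (by fun_prop : Continuous fun θ : ℝ => |Real.cos (θ / 2)|).rpow_const fun _ => Or.inr hp

lemma cos_half_pos {θ : ℝ} (h : θ ∈ Set.Ioo 0 Real.pi) : 0 < Real.cos (θ / 2) :=
  Real.cos_pos_of_mem_Ioo ⟨by linarith [h.1, Real.pi_pos], by linarith [h.2]⟩

lemma cosMoment_succ {α : ℝ} (hα : 0 < α) (k : ℕ) :
    (α + k + 1) * cosMoment α (k + 1) = (α - k) * cosMoment α k := by
  have hcont := continuous_abs_cos_half_rpow (p := 2 * α) (by positivity)
  have hcont' := continuous_abs_cos_half_rpow (p := 2 * α + 1) (by positivity)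
  have key : ∫ θ in (0 : ℝ)..Real.pi,
      ((α + k + 1) * (|Real.cos (θ / 2)| ^ (2 * α) * Real.cos ((k + 1 : ℕ) * θ)) -
        (α - k) * (|Real.cos (θ / 2)| ^ (2 * α) * Real.cos (k * θ))) =
      2 * (|Real.cos (Real.pi / 2)| ^ (2 * α + 1) * Real.sin ((k + 1 / 2) * Real.pi)) -
        2 * (|Real.cos (0 / 2)| ^ (2 * α + 1) * Real.sin ((k + 1 / 2) * 0)) := by
    refine intervalIntegral.integral_eq_sub_of_hasDerivAt_of_le
      (f := fun θ => 2 * (|Real.cos (θ / 2)| ^ (2 * α + 1) * Real.sin ((k + 1 / 2) * θ)))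
      Real.pi_pos.le (by fun_prop) (fun θ hθ => ?_) (by
        apply Continuous.intervalIntegrable; fun_prop)
    have hc := cos_half_pos hθ
    have h1 : HasDerivAt (fun θ : ℝ => Real.cos (θ / 2)) (-Real.sin (θ / 2) * (1 / 2)) θ :=
      ((hasDerivAt_id θ).div_const 2).cos
    have h2 : HasDerivAt (fun θ : ℝ => Real.sin ((k + 1 / 2) * θ))
        (Real.cos ((k + 1 / 2) * θ) * ((k + 1 / 2) * 1)) θ :=
      ((hasDerivAt_id θ).const_mul ((k : ℝ) + 1 / 2)).sin
    have h3 := ((h1.rpow_const (p := 2 * α + 1) (Or.inr (by linarith))).mul h2).const_mul 2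
    have h4 : (fun θ : ℝ => 2 * (|Real.cos (θ / 2)| ^ (2 * α + 1) * Real.sin ((k + 1 / 2) * θ)))
        =ᶠ[nhds θ] fun θ => 2 * (Real.cos (θ / 2) ^ (2 * α + 1) * Real.sin ((k + 1 / 2) * θ)) := by
      filter_upwards [Ioo_mem_nhds hθ.1 hθ.2] with x hx
      rw [abs_of_pos (cos_half_pos hx)]
    refine (h3.congr_of_eventuallyEq h4).congr_deriv ?_
    rw [abs_of_pos hc, add_sub_cancel_right, Real.rpow_add_one hc.ne',
      show ((k + 1 : ℕ) : ℝ) * θ = (k + 1 / 2) * θ + θ / 2 by push_cast; ring,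
      show (k : ℝ) * θ = (k + 1 / 2) * θ - θ / 2 by ring, Real.cos_add, Real.cos_sub]
    ring
  rw [intervalIntegral.integral_sub, intervalIntegral.integral_const_mul,
    intervalIntegral.integral_const_mul] at key
  · rw [Real.cos_pi_div_two, abs_zero, Real.zero_rpow (by linarith)] at key
    simp only [zero_mul, mul_zero, Real.sin_zero, sub_self] at key
    exact sub_eq_zero.mp key
  all_goals apply Continuous.intervalIntegrable; fun_prop

lemma image_cos_half_sq :
    (fun θ : ℝ => Real.cos (θ / 2) ^ 2) '' Set.Ioo 0 Real.pi = Set.Ioo 0 1 := by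
  ext x
  constructor
  · rintro ⟨θ, hθ, rfl⟩
    have hc := cos_half_pos hθ
    have hs : 0 < Real.sin (θ / 2) :=
      Real.sin_pos_of_pos_of_lt_pi (by linarith [hθ.1]) (by linarith [hθ.2, Real.pi_pos])
    exact ⟨by positivity, by nlinarith [Real.sin_sq_add_cos_sq (θ / 2)]⟩
  · rintro ⟨h0, h1⟩
    have hs0 : 0 < √x := Real.sqrt_pos.2 h0
    have hs1 : √x < 1 := by rw [Real.sqrt_lt' one_pos]; simpa
    refine ⟨2 * Real.arccos √x, ⟨?_, ?_⟩, ?_⟩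
    · linarith [Real.arccos_pos.2 hs1]
    · linarith [Real.arccos_lt_pi_div_two.2 hs0]
    · simp only
      rw [mul_div_cancel_left₀ _ two_ne_zero, Real.cos_arccos (by linarith) hs1.le,
        Real.sq_sqrt h0.le]

lemma injOn_cos_half_sq :
    Set.InjOn (fun θ : ℝ => Real.cos (θ / 2) ^ 2) (Set.Ioo 0 Real.pi) := by
  intro x hx y hy h
  have := (pow_left_inj₀ (cos_half_pos hx).le (cos_half_pos hy).le two_ne_zero).1 h
  have := Real.injOn_cos ⟨by linarith [hx.1], by linarith [hx.2, Real.pi_pos]⟩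
    ⟨by linarith [hy.1], by linarith [hy.2, Real.pi_pos]⟩ this
  linarith

lemma integral_rpow_mul_one_sub_rpow {u v : ℝ} (hu : 0 < u) (hv : 0 < v) :
    ∫ x in Set.Ioo (0 : ℝ) 1, x ^ (u - 1) * (1 - x) ^ (v - 1) =
      Real.Gamma u * Real.Gamma v / Real.Gamma (u + v) := by
  have h := Complex.betaIntegral_eq_Gamma_mul_div u v (by simpa) (by simpa)
  rw [Complex.betaIntegral, intervalIntegral.integral_of_le zero_le_one,
    integral_Ioc_eq_integral_Ioo, ← Complex.ofReal_add, Complex.Gamma_ofReal,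
    Complex.Gamma_ofReal, Complex.Gamma_ofReal] at h
  apply Complex.ofReal_injective
  push_cast
  rw [← h, ← integral_complex_ofReal]
  refine setIntegral_congr_fun measurableSet_Ioo fun x hx => ?_
  simp only [Complex.ofReal_mul]
  rw [Complex.ofReal_cpow hx.1.le, Complex.ofReal_cpow (by linarith [hx.2])]
  push_cast
  rfl

lemma cosMoment_zero {α : ℝ} (hα : 0 < α) :
    cosMoment α 0 = √Real.pi * Real.Gamma (α + 1 / 2) / Real.Gamma (α + 1) := by
  have h := integral_rpow_mul_one_sub_rpow (u := α + 1 / 2) (v := 1 / 2) (by positivity)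
    (by positivity)
  have hd : ∀ θ ∈ Set.Ioo 0 Real.pi, HasDerivWithinAt (fun θ : ℝ => Real.cos (θ / 2) ^ 2)
      (-(Real.cos (θ / 2) * Real.sin (θ / 2))) (Set.Ioo 0 Real.pi) θ := fun θ _ =>
    ((((hasDerivAt_id θ).div_const 2).cos.pow 2).congr_deriv (by simp; ring)).hasDerivWithinAt
  rw [← image_cos_half_sq, integral_image_eq_integral_abs_deriv_smul measurableSet_Ioo hd
    injOn_cos_half_sq, Real.Gamma_one_half_eq, show α + 1 / 2 + 1 / 2 = α + 1 by ring] at h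
  rw [mul_comm, ← h, cosMoment, intervalIntegral.integral_of_le Real.pi_pos.le,
    integral_Ioc_eq_integral_Ioo]
  refine setIntegral_congr_fun measurableSet_Ioo fun θ hθ => ?_
  have hc := cos_half_pos hθ
  have hs : 0 < Real.sin (θ / 2) :=
    Real.sin_pos_of_pos_of_lt_pi (by linarith [hθ.1]) (by linarith [hθ.2, Real.pi_pos])
  have h1 : (1 - Real.cos (θ / 2) ^ 2) = Real.sin (θ / 2) ^ 2 := by
    linarith [Real.sin_sq_add_cos_sq (θ / 2)]
  simp only [Nat.cast_zero, zero_mul, Real.cos_zero, mul_one, smul_eq_mul, h1]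
  rw [abs_of_pos hc, abs_neg, abs_of_pos (mul_pos hc hs), ← Real.rpow_natCast,
    ← Real.rpow_natCast, ← Real.rpow_mul hc.le, ← Real.rpow_mul hs.le]
  have h2 : ((2 : ℕ) : ℝ) * (1 / 2 - 1) = -1 := by norm_num
  have h3 : 2 * α = ((2 : ℕ) : ℝ) * (α + 1 / 2 - 1) + 1 := by push_cast; ring
  rw [h2, Real.rpow_neg_one, h3, Real.rpow_add_one hc.ne']
  field_simp

lemma sub_natCast_ne_zero_of_nonint {α : ℝ} (hα : ∀ k : ℕ, α ≠ k) (k : ℕ) : α - k ≠ 0 :=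
  sub_ne_zero.2 (hα k)

lemma chebCoeff_succ {α : ℝ} (L : ℝ) (hα : 0 < α) (hni : ∀ k : ℕ, α ≠ k) (k : ℕ) :
    (α + k + 1) * chebCoeff α L (k + 1) = (α - k) * chebCoeff α L k := by
  have h0 := sub_natCast_ne_zero_of_nonint hni k
  have h1 : Real.Gamma (α - k + 1) = (α - k) * Real.Gamma (α - k) := Real.Gamma_add_one h0
  have h2 : Real.Gamma (α + k + 1 + 1) = (α + k + 1) * Real.Gamma (α + k + 1) :=
    Real.Gamma_add_one (by positivity)
  have h3 : Real.Gamma (α + k + 1) ≠ 0 := (Real.Gamma_pos_of_pos (by positivity)).ne'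
  have h4 : Real.Gamma (α - k) ≠ 0 := by
    refine Real.Gamma_ne_zero fun m hm => hni (k - m) ?_
    have : m ≤ k := by exact_mod_cast (by linarith : (m : ℝ) ≤ k)
    rw [Nat.cast_sub this]
    linarith
  have h5 : α + k + 1 ≠ 0 := by positivity
  have h6 := Real.sqrt_pos.2 Real.pi_pos
  rw [chebCoeff, chebCoeff, show α - ((k + 1 : ℕ) : ℝ) + 1 = α - k by push_cast; ring,
    show α + ((k + 1 : ℕ) : ℝ) + 1 = α + k + 1 + 1 by push_cast; ring, h1, h2]
  field_simp

lemma chebCoeff_eq_cosMoment {α : ℝ} (L : ℝ) (hα : 0 < α) (hni : ∀ k : ℕ, α ≠ k) (k : ℕ) :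
    chebCoeff α L k = L ^ α * (2 / Real.pi) * cosMoment α k := by
  induction k with
  | zero =>
    have h3 : Real.Gamma (α + 1) ≠ 0 := (Real.Gamma_pos_of_pos (by positivity)).ne'
    have h6 := Real.sqrt_pos.2 Real.pi_pos
    have h7 := Real.sq_sqrt Real.pi_pos.le
    rw [chebCoeff, cosMoment_zero hα, Nat.cast_zero, sub_zero, add_zero]
    field_simp
    rw [h7]
  | succ k ih =>
    have h5 : α + k + 1 ≠ 0 := by positivity
    apply mul_left_cancel₀ h5
    rw [chebCoeff_succ L hα hni, ih]
    linear_combination (-L ^ α * (2 / Real.pi)) * cosMoment_succ hα k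

/-- The ratio `Γ(k - α) / Γ(k + α)`, whose differences dominate the Chebyshev coefficients. -/
noncomputable def gammaRatio (α : ℝ) (k : ℕ) : ℝ :=
  Real.Gamma (k - α) / Real.Gamma (k + α)

lemma gammaRatio_nonneg {α : ℝ} (hα : 0 < α) {k : ℕ} (hk : α < k) : 0 ≤ gammaRatio α k :=
  div_nonneg (Real.Gamma_pos_of_pos (by linarith)).le (Real.Gamma_pos_of_pos (by linarith)).le

lemma gammaRatio_sub_succ {α : ℝ} (hα : 0 < α) {k : ℕ} (hk : α < k) :
    gammaRatio α k - gammaRatio α (k + 1) =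
      2 * α * (Real.Gamma (k - α) / Real.Gamma (α + k + 1)) := by
  have h1 : Real.Gamma ((k + 1 : ℕ) - α) = (k - α) * Real.Gamma (k - α) := by
    rw [← Real.Gamma_add_one (by linarith)]; push_cast; ring_nf
  have h2 : Real.Gamma ((k + 1 : ℕ) + α) = (k + α) * Real.Gamma (k + α) := by
    rw [← Real.Gamma_add_one (by linarith)]; push_cast; ring_nf
  have h3 : Real.Gamma (α + k + 1) = (k + α) * Real.Gamma (k + α) := by
    rw [← Real.Gamma_add_one (by linarith)]; ring_nf
  have h4 : Real.Gamma (k + α) ≠ 0 := (Real.Gamma_pos_of_pos (by linarith)).ne'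
  have h5 : (k : ℝ) + α ≠ 0 := by linarith
  rw [gammaRatio, gammaRatio, h1, h2, h3]
  field_simp
  ring

lemma abs_inv_Gamma_le {α : ℝ} {k : ℕ} (hk : α < k) :
    |(Real.Gamma (α - k + 1))⁻¹| ≤ Real.Gamma (k - α) / Real.pi := by
  have h := Real.Gamma_mul_Gamma_one_sub (k - α)
  rw [show 1 - ((k : ℝ) - α) = α - k + 1 by ring] at h
  have hpos : 0 < Real.Gamma (k - α) := Real.Gamma_pos_of_pos (by linarith)
  have hsin : |Real.sin (Real.pi * (k - α))| ≤ 1 := Real.abs_sin_le_one _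
  rcases eq_or_ne (Real.Gamma (α - k + 1)) 0 with h0 | h0
  · rw [h0, _root_.inv_zero, abs_zero]
    positivity
  have hs0 : Real.sin (Real.pi * (k - α)) ≠ 0 := by
    intro hs
    rw [hs, div_zero] at h
    exact (mul_ne_zero hpos.ne' h0) h
  have : (Real.Gamma (α - k + 1))⁻¹ =
      Real.Gamma (k - α) / Real.pi * Real.sin (Real.pi * (k - α)) := by
    have := Real.pi_ne_zero
    rw [eq_div_iff hs0] at h
    rw [div_mul_eq_mul_div, eq_div_iff this, inv_mul_eq_iff_eq_mul₀ h0]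
    linarith
  rw [this, abs_mul, abs_of_pos (by positivity)]
  exact mul_le_of_le_one_right (by positivity) hsin

lemma sqrt_pi_mul_pi : √Real.pi * Real.pi = Real.pi ^ ((3 : ℝ) / 2) := by
  rw [Real.sqrt_eq_rpow, ← Real.rpow_add_one Real.pi_ne_zero]
  norm_num

lemma abs_chebCoeff_le {α L : ℝ} (hL : 0 ≤ L) (hα : 0 < α) {k : ℕ}
    (hk : α < k) :
    |chebCoeff α L k| ≤ L ^ α * (Real.Gamma (α + 1 / 2) * Real.Gamma α /
      Real.pi ^ ((3 : ℝ) / 2)) * (gammaRatio α k - gammaRatio α (k + 1)) := by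
  have h1 : 0 < Real.Gamma (α + 1 / 2) := Real.Gamma_pos_of_pos (by positivity)
  have h2 : 0 < Real.Gamma α := Real.Gamma_pos_of_pos hα
  have h3 : 0 < Real.Gamma (α + k + 1) := Real.Gamma_pos_of_pos (by positivity)
  have h4 := Real.sqrt_pos.2 Real.pi_pos
  have hc : chebCoeff α L k = 2 * L ^ α * Real.Gamma (α + 1 / 2) * (α * Real.Gamma α) /
      (√Real.pi * Real.Gamma (α + k + 1)) * (Real.Gamma (α - k + 1))⁻¹ := by
    rw [chebCoeff, Real.Gamma_add_one hα.ne', ← div_eq_mul_inv, div_div]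
    ring_nf
  rw [hc, abs_mul, abs_of_nonneg (by positivity), gammaRatio_sub_succ hα hk, ← sqrt_pi_mul_pi]
  refine (mul_le_mul_of_nonneg_left (abs_inv_Gamma_le hk) (by positivity)).trans_eq ?_
  field_simp

lemma Gamma_div_Gamma_add_le {y c : ℝ} (hy : 1 < y) (hc : 0 < c) :
    Real.Gamma y / Real.Gamma (y + c) ≤ (y - 1) ^ (-c) := by
  have h := Real.convexOn_log_Gamma.slope_mono_adjacent (x := y - 1) (y := y) (z := y + c)
    (Set.mem_Ioi.2 (by linarith)) (Set.mem_Ioi.2 (by linarith)) (by linarith) (by linarith)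
  have hG : Real.Gamma y = (y - 1) * Real.Gamma (y - 1) := by
    rw [← Real.Gamma_add_one (by linarith), sub_add_cancel]
  have p1 : 0 < Real.Gamma (y - 1) := Real.Gamma_pos_of_pos (by linarith)
  have p2 : 0 < Real.Gamma y := Real.Gamma_pos_of_pos (by linarith)
  have p3 : 0 < Real.Gamma (y + c) := Real.Gamma_pos_of_pos (by linarith)
  have hl : Real.log (Real.Gamma y) = Real.log (y - 1) + Real.log (Real.Gamma (y - 1)) := by
    rw [hG, Real.log_mul (by linarith) p1.ne']
  simp only [Function.comp_apply, hl, sub_sub_cancel, div_one, add_sub_cancel_left,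
    add_sub_cancel_right] at h
  rw [le_div_iff₀ hc, ← hl] at h
  rw [← Real.log_le_log_iff (by positivity) (Real.rpow_pos_of_pos (by linarith) _),
    Real.log_div p2.ne' p3.ne', Real.log_rpow (by linarith)]
  linarith

lemma summable_abs_of_le_sub {a f : ℕ → ℝ} (ha : ∀ k, 0 ≤ a k)
    (hf : ∀ k, |f k| ≤ a k - a (k + 1)) :
    Summable (fun k => |f k|) ∧ ∑' k, |f k| ≤ a 0 := by
  have hs : ∀ n, ∑ k ∈ Finset.range n, |f k| ≤ a 0 := fun n => by
    refine (Finset.sum_le_sum fun k _ => hf k).trans ?_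
    rw [Finset.sum_range_sub']
    linarith [ha n]
  exact ⟨summable_of_sum_range_le (fun _ => abs_nonneg _) hs,
    Real.tsum_le_of_sum_range_le (fun _ => abs_nonneg _) hs⟩

lemma chebCoeff_tail {α L : ℝ} (hL : 0 ≤ L) (hα : 0 < α) {m : ℕ}
    (hm : α < m) :
    Summable (fun k => |chebCoeff α L (k + (m + 1))|) ∧
      ∑' k, |chebCoeff α L (k + (m + 1))| ≤
        L ^ α * (Real.Gamma (α + 1 / 2) * Real.Gamma α / Real.pi ^ ((3 : ℝ) / 2)) *
          (m - α) ^ (-(2 * α)) := by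
  have h1 : 0 < Real.Gamma (α + 1 / 2) := Real.Gamma_pos_of_pos (by positivity)
  have h2 : 0 < Real.Gamma α := Real.Gamma_pos_of_pos hα
  have hA : 0 ≤ L ^ α * (Real.Gamma (α + 1 / 2) * Real.Gamma α / Real.pi ^ ((3 : ℝ) / 2)) := by
    positivity
  have hk : ∀ k : ℕ, α < ((k + (m + 1) : ℕ) : ℝ) := fun k => by
    push_cast; linarith [k.cast_nonneg (α := ℝ)]
  obtain ⟨hs, ht⟩ := summable_abs_of_le_sub (f := fun k => chebCoeff α L (k + (m + 1)))
    (a := fun k => L ^ α * (Real.Gamma (α + 1 / 2) * Real.Gamma α / Real.pi ^ ((3 : ℝ) / 2)) *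
      gammaRatio α (k + (m + 1)))
    (fun k => mul_nonneg hA (gammaRatio_nonneg hα (hk k)))
    (fun k => by
      rw [← mul_sub]
      convert abs_chebCoeff_le hL hα (hk k) using 4
      ring)
  refine ⟨hs, ht.trans (mul_le_mul_of_nonneg_left ?_ hA)⟩
  have := Gamma_div_Gamma_add_le (y := m + 1 - α) (c := 2 * α) (by linarith) (by positivity)
  rw [show (m : ℝ) + 1 - α + 2 * α = m + 1 + α by ring,
    show (m : ℝ) + 1 - α - 1 = m - α by ring] at this
  simpa [gammaRatio] using this

instance fact_two_pi_pos : Fact (0 < 2 * Real.pi) := ⟨Real.two_pi_pos⟩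

lemma periodic_abs_cos_half_rpow (p : ℝ) :
    Function.Periodic (fun θ : ℝ => ((|Real.cos (θ / 2)| ^ p : ℝ) : ℂ)) (2 * Real.pi) := by
  intro θ
  simp only
  rw [show (θ + 2 * Real.pi) / 2 = θ / 2 + Real.pi by ring, Real.cos_add_pi, abs_neg]

/-- The function `θ ↦ |cos (θ/2)|^{2α}` on the circle `ℝ / 2πℤ`. -/
noncomputable def absCosHalfRpow {α : ℝ} (hα : 0 < α) : C(AddCircle (2 * Real.pi), ℂ) where
  toFun := (periodic_abs_cos_half_rpow (2 * α)).lift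
  continuous_toFun := continuous_quot_lift _
    (Complex.continuous_ofReal.comp (continuous_abs_cos_half_rpow (by positivity)))

lemma fourierCoeff_absCosHalfRpow {α : ℝ} (hα : 0 < α) (n : ℤ) :
    fourierCoeff (absCosHalfRpow hα) n = ((cosMoment α n.natAbs / Real.pi : ℝ) : ℂ) := by
  have hcont := continuous_abs_cos_half_rpow (p := 2 * α) (by positivity)
  rw [fourierCoeff_eq_intervalIntegral _ _ (-Real.pi),
    show -Real.pi + 2 * Real.pi = Real.pi by ring]
  have hf : ∀ x : ℝ, (fourier (-n) (x : AddCircle (2 * Real.pi)) • absCosHalfRpow hα x : ℂ) =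
      ((|Real.cos (x / 2)| ^ (2 * α) * Real.cos (n * x) : ℝ) : ℂ) -
      ((|Real.cos (x / 2)| ^ (2 * α) * Real.sin (n * x) : ℝ) : ℂ) * Complex.I := fun x => by
    rw [fourier_coe_apply]
    have : absCosHalfRpow hα x = ((|Real.cos (x / 2)| ^ (2 * α) : ℝ) : ℂ) := rfl
    rw [this, show 2 * (Real.pi : ℂ) * Complex.I * ((-n : ℤ) : ℂ) * x / ((2 * Real.pi : ℝ) : ℂ) =
      ((-(n * x) : ℝ) : ℂ) * Complex.I by
        have := Real.pi_ne_zero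
        push_cast
        field_simp, Complex.exp_mul_I]
    push_cast
    rw [Complex.cos_neg, Complex.sin_neg]
    simp only [smul_eq_mul]
    ring
  simp_rw [hf]
  have hneg : ∀ g : ℝ → ℝ, Continuous g → ∫ x in -Real.pi..Real.pi, g x =
      ∫ x in (0 : ℝ)..Real.pi, (g (-x) + g x) := fun g hg => by
    rw [intervalIntegral.integral_add, intervalIntegral.integral_comp_neg, neg_zero,
      intervalIntegral.integral_add_adjacent_intervals]
    all_goals apply Continuous.intervalIntegrable; fun_prop
  rw [intervalIntegral.integral_sub, intervalIntegral.integral_mul_const,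
    intervalIntegral.integral_ofReal, intervalIntegral.integral_ofReal,
    hneg _ (by fun_prop), hneg _ (by fun_prop)]
  · have hc : ∀ x : ℝ, Real.cos (n * x) = Real.cos (n.natAbs * x) := fun x => by
      rcases Int.natAbs_eq n with h | h
      · rw [h]; simp
      · rw [h]; simp
    simp only [neg_div, Real.cos_neg, mul_neg, Real.sin_neg, neg_add_cancel, hc]
    rw [intervalIntegral.integral_zero, Complex.ofReal_zero, zero_mul, sub_zero,
      intervalIntegral.integral_add, Complex.real_smul, ← Complex.ofReal_mul]
    · congr 1
      change 1 / (2 * Real.pi) * (cosMoment α n.natAbs + cosMoment α n.natAbs) = _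
      have := Real.pi_ne_zero
      field_simp
      ring
    all_goals apply Continuous.intervalIntegrable; fun_prop
  all_goals apply Continuous.intervalIntegrable; fun_prop

lemma summable_cosMoment {α : ℝ} (hα : 0 < α) (hni : ∀ k : ℕ, α ≠ k) :
    Summable (cosMoment α) := by
  obtain ⟨m, hm⟩ := exists_nat_gt α
  have h := (chebCoeff_tail (L := 1) zero_le_one hα hm).1.of_abs
  rw [summable_nat_add_iff] at h
  refine (h.mul_left (Real.pi / 2)).congr fun k => ?_
  have := Real.pi_ne_zero
  rw [chebCoeff_eq_cosMoment 1 hα hni, Real.one_rpow]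
  field_simp

lemma hasSum_cosMoment_mul_cos {α : ℝ} (hα : 0 < α) (hni : ∀ k : ℕ, α ≠ k) (θ : ℝ) :
    HasSum (fun k : ℕ => 2 / Real.pi * cosMoment α k * Real.cos (k * θ))
      (|Real.cos (θ / 2)| ^ (2 * α) + cosMoment α 0 / Real.pi) := by
  have hs : Summable (fourierCoeff (absCosHalfRpow hα)) := by
    have h := Complex.hasSum_ofReal.2 ((summable_cosMoment hα hni).div_const Real.pi).hasSum
    refine Summable.of_nat_of_neg ?_ ?_ <;>
    · simp only [fourierCoeff_absCosHalfRpow, Int.natAbs_neg, Int.natAbs_natCast]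
      exact h.summable
  have h := (has_pointwise_sum_fourier_series_of_summable hs (θ : AddCircle (2 * Real.pi))).nat_add_neg
  simp only [fourierCoeff_absCosHalfRpow, Int.natAbs_neg, Int.natAbs_natCast, fourier_zero,
    smul_eq_mul, mul_one, Int.natAbs_zero] at h
  rw [← Complex.hasSum_ofReal]
  convert h using 1
  · ext k
    rw [fourier_coe_apply, fourier_coe_apply]
    have e : ∀ j : ℤ, 2 * (Real.pi : ℂ) * Complex.I * (j : ℂ) * θ / ((2 * Real.pi : ℝ) : ℂ) =
        (j * θ : ℂ) * Complex.I := fun j => by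
      have := Real.pi_ne_zero
      push_cast
      field_simp
    rw [e, e, ← mul_add, Int.cast_neg, neg_mul, ← Complex.two_cos]
    push_cast
    ring
  · push_cast
    rfl

/-- The polynomial `c₀/2 + ∑_{k=1}^m c_k T_k(2X/L - 1)`. -/
noncomputable def chebApproxPoly (α L : ℝ) (m : ℕ) : Polynomial ℝ :=
  Polynomial.C (chebCoeff α L 0 / 2) + ∑ k ∈ Finset.Icc 1 m, Polynomial.C (chebCoeff α L k) *
    (Polynomial.Chebyshev.T ℝ (k : ℤ)).comp (Polynomial.C (2 / L) * Polynomial.X - 1)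

lemma abs_rpow_sub_eval_chebApproxPoly_le {α L x : ℝ} (hL : 0 < L) (hα : 0 < α)
    (hni : ∀ k : ℕ, α ≠ k) {m : ℕ} (hm : α < m) (hx : x ∈ Set.Icc 0 L) :
    |x ^ α - (chebApproxPoly α L m).eval x| ≤
      L ^ α * (Real.Gamma (α + 1 / 2) * Real.Gamma α / Real.pi ^ ((3 : ℝ) / 2)) *
        (m - α) ^ (-(2 * α)) := by
  have hxL : x / L ∈ Set.Icc (0 : ℝ) 1 :=
    ⟨div_nonneg hx.1 hL.le, (div_le_one hL).2 hx.2⟩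
  set θ := Real.arccos (2 / L * x - 1) with hθ
  have hy : 2 / L * x - 1 = 2 * (x / L) - 1 := by ring
  have hcos : Real.cos θ = 2 / L * x - 1 := by
    apply Real.cos_arccos <;> rw [hy] <;> linarith [hxL.1, hxL.2]
  have hpow : |Real.cos (θ / 2)| ^ (2 * α) = x ^ α / L ^ α := by
    rw [Real.rpow_mul (abs_nonneg _), Real.rpow_two, sq_abs, ← Real.div_rpow hx.1 hL.le,
      Real.cos_sq, mul_div_cancel₀ _ two_ne_zero, hcos, hy]
    congr 1
    ring
  have hLα : L ^ α ≠ 0 := (Real.rpow_pos_of_pos hL α).ne'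
  have hsum := (hasSum_cosMoment_mul_cos hα hni θ).mul_left (L ^ α)
  have hterm : ∀ k : ℕ, L ^ α * (2 / Real.pi * cosMoment α k * Real.cos (k * θ)) =
      chebCoeff α L k * Real.cos (k * θ) := fun k => by
    rw [chebCoeff_eq_cosMoment L hα hni]; ring
  simp only [hterm] at hsum
  have hsum' := (hasSum_nat_add_iff' (m + 1)).2 hsum
  have heval : (chebApproxPoly α L m).eval x =
      chebCoeff α L 0 / 2 + ∑ k ∈ Finset.Icc 1 m, chebCoeff α L k * Real.cos (k * θ) := by
    simp only [chebApproxPoly, Polynomial.eval_add, Polynomial.eval_C, Polynomial.eval_finsetSum,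
      Polynomial.eval_mul, Polynomial.eval_comp, Polynomial.eval_sub, Polynomial.eval_X,
      Polynomial.eval_one, ← hcos, Polynomial.Chebyshev.T_real_cos, Int.cast_natCast]
  have hrest : x ^ α - (chebApproxPoly α L m).eval x =
      ∑' k, chebCoeff α L (k + (m + 1)) * Real.cos ((k + (m + 1) : ℕ) * θ) := by
    rw [hsum'.tsum_eq, heval, Finset.range_eq_Ico, Finset.sum_eq_sum_Ico_succ_bot (by lia), hpow,
      mul_add, mul_div_cancel₀ _ hLα, chebCoeff_eq_cosMoment L hα hni 0]
    simp only [Nat.cast_zero, zero_mul, Real.cos_zero, mul_one, zero_add]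
    rw [show Finset.Ico 1 (m + 1) = Finset.Icc 1 m from rfl]
    ring
  obtain ⟨hs, ht⟩ := chebCoeff_tail hL.le hα hm
  rw [hrest, ← Real.norm_eq_abs]
  refine (tsum_of_norm_bounded hs.hasSum fun k => ?_).trans ht
  rw [Real.norm_eq_abs, abs_mul]
  exact mul_le_of_le_one_right (abs_nonneg _) (Real.abs_cos_le_one _)

lemma abs_rpow_sub_eval_chebApproxPoly_le_of_degree {α l L κ ε x : ℝ} (hl : 0 < l)
    (hκ : κ = L / l) (hα : 0 < α) (hni : ∀ k : ℕ, α ≠ k) (hε : 0 < ε) {m : ℕ}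
    (hm : α + √κ * (Real.Gamma (α + 1 / 2) * Real.Gamma α / (ε * Real.pi ^ ((3 : ℝ) / 2))) ^
      (1 / (2 * α)) ≤ m) (hx : x ∈ Set.Icc l L) :
    |x ^ α - (chebApproxPoly α L m).eval x| ≤ ε * x ^ α := by
  have hL : 0 < L := hl.trans_le (hx.1.trans hx.2)
  have hκ0 : 0 < κ := hκ ▸ div_pos hL hl
  have h1 : 0 < Real.Gamma (α + 1 / 2) := Real.Gamma_pos_of_pos (by positivity)
  have h2 : 0 < Real.Gamma α := Real.Gamma_pos_of_pos hα
  have hp := Real.rpow_pos_of_pos Real.pi_pos ((3 : ℝ) / 2)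
  set D := Real.Gamma (α + 1 / 2) * Real.Gamma α / (ε * Real.pi ^ ((3 : ℝ) / 2)) with hD
  have hD0 : 0 < D := by positivity
  have hb : 0 < √κ * D ^ (1 / (2 * α)) := by positivity
  have hαm : α < m := by linarith
  refine (abs_rpow_sub_eval_chebApproxPoly_le hL hα hni hαm ⟨hl.le.trans hx.1, hx.2⟩).trans ?_
  have hpow : (√κ * D ^ (1 / (2 * α))) ^ (2 * α) = κ ^ α * D := by
    rw [Real.mul_rpow (by positivity) (by positivity), ← Real.rpow_mul hD0.le,
      one_div_mul_cancel (by positivity), Real.rpow_one, Real.rpow_mul (by positivity),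
      Real.rpow_two, Real.sq_sqrt hκ0.le]
  have hle : κ ^ α * D ≤ (m - α) ^ (2 * α) := by
    rw [← hpow]
    exact Real.rpow_le_rpow hb.le (by linarith) (by positivity)
  have hLκ : L ^ α = κ ^ α * l ^ α := by
    rw [← Real.mul_rpow hκ0.le hl.le, hκ, div_mul_cancel₀ _ hl.ne']
  rw [Real.rpow_neg (by linarith), ← div_eq_mul_inv, div_le_iff₀
    (Real.rpow_pos_of_pos (by linarith) _)]
  calc L ^ α * (Real.Gamma (α + 1 / 2) * Real.Gamma α / Real.pi ^ ((3 : ℝ) / 2))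
      = ε * l ^ α * (κ ^ α * D) := by rw [hLκ, hD]; field_simp
    _ ≤ ε * x ^ α * (m - α) ^ (2 * α) := by
      have := Real.rpow_le_rpow hl.le hx.1 hα.le
      have h3 : 0 ≤ κ ^ α * D := by positivity
      have h4 : 0 ≤ x ^ α := Real.rpow_nonneg (hl.le.trans hx.1) α
      gcongr

lemma inv_one_sub_two_mul_le_exp {t : ℝ} (ht : |t| ≤ 1 / 12) :
    (1 - 2 * t)⁻¹ ≤ Real.exp (2 * t + 4 * t ^ 2) := by
  obtain ⟨h1, h2⟩ := abs_le.1 ht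
  have hpos : 0 < 1 - 2 * t := by linarith
  rw [inv_le_iff_one_le_mul₀' hpos]
  rcases le_total 0 t with h | h
  · have he := Real.quadratic_le_exp_of_nonneg (x := 2 * t + 4 * t ^ 2) (by positivity)
    refine le_trans ?_ (mul_le_mul_of_nonneg_left he hpos.le)
    have h3 : 0 ≤ t ^ 2 * (1 - 6 * t) := mul_nonneg (sq_nonneg t) (by linarith)
    have h4 : 0 ≤ (1 - 2 * t) * (8 * t ^ 3 + 8 * t ^ 4) := by positivity
    nlinarith
  · have he := Real.add_one_le_exp (2 * t + 4 * t ^ 2)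
    refine le_trans ?_ (mul_le_mul_of_nonneg_left he hpos.le)
    nlinarith [mul_nonneg (sq_nonneg t) (neg_nonneg.2 h)]

lemma integral_exp_mul_sq_gaussianReal {t : ℝ} (ht : t < 1 / 2) :
    ∫ x, Real.exp (t * x ^ 2) ∂gaussianReal 0 1 = √(1 - 2 * t)⁻¹ := by
  rw [integral_gaussianReal_eq_integral_smul one_ne_zero]
  have : ∀ x : ℝ, gaussianPDFReal 0 1 x • Real.exp (t * x ^ 2) =
      (√(2 * Real.pi))⁻¹ * Real.exp (-(1 / 2 - t) * x ^ 2) := fun x => by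
    rw [gaussianPDFReal, smul_eq_mul, mul_assoc, ← Real.exp_add]
    congr 2
    · simp
    · simp; ring
  simp_rw [this]
  rw [integral_const_mul, integral_gaussian, ← Real.sqrt_inv, ← Real.sqrt_mul (by positivity)]
  congr 1
  have := Real.pi_ne_zero
  have : 1 - 2 * t ≠ 0 := by linarith
  have : 1 / 2 - t ≠ 0 := by linarith
  field_simp

lemma integrable_exp_mul_sq_gaussianReal {t : ℝ} (ht : t < 1 / 2) :
    Integrable (fun x => Real.exp (t * x ^ 2)) (gaussianReal 0 1) := by
  refine not_imp_comm.1 integral_undef ?_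
  rw [integral_exp_mul_sq_gaussianReal ht]
  exact (Real.sqrt_pos.2 (inv_pos.2 (by linarith))).ne'

lemma integral_exp_mul_sq_gaussianReal_le {t : ℝ} (ht : |t| ≤ 1 / 12) :
    ∫ x, Real.exp (t * x ^ 2) ∂gaussianReal 0 1 ≤ Real.exp (t + 2 * t ^ 2) := by
  rw [integral_exp_mul_sq_gaussianReal (by linarith [le_abs_self t]), Real.sqrt_le_left
    (Real.exp_pos _).le, ← Real.exp_nat_mul]
  convert inv_one_sub_two_mul_le_exp ht using 2
  push_cast
  ring

lemma map_pi_gaussianReal_inner {ι : Type*} [Fintype ι]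
    (b : OrthonormalBasis ι ℝ (EuclideanSpace ℝ ι)) (i : ι) :
    (Measure.pi fun _ : ι => gaussianReal 0 1).map (fun g => (b i).ofLp ⬝ᵥ g) =
      gaussianReal 0 1 := by
  classical
  have h := map_pi_eq_stdGaussian (ι := ι)
  rw [stdGaussian_eq_map_pi_orthonormalBasis b] at h
  have h' := congrArg (Measure.map fun v => inner ℝ (b i) v) h
  rw [Measure.map_map (by fun_prop) (by fun_prop), Measure.map_map (by fun_prop) (by fun_prop)]
    at h'
  have e1 : ((fun v => inner ℝ (b i) v) ∘ WithLp.toLp 2) = fun g : ι → ℝ => (b i).ofLp ⬝ᵥ g := by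
    ext g
    simp [EuclideanSpace.inner_eq_star_dotProduct, dotProduct_comm]
  have e2 : ((fun v => inner ℝ (b i) v) ∘ fun x : ι → ℝ => ∑ j, x j • b j) = fun x => x i := by
    ext x
    simp [inner_sum, inner_smul_right, orthonormal_iff_ite.1 b.orthonormal]
  rw [e1, e2] at h'
  rw [h']
  exact (measurePreserving_eval (fun _ : ι => gaussianReal 0 1) i).map_eq

lemma measurable_dotProduct_left {ι : Type*} [Fintype ι] (u : ι → ℝ) :
    Measurable fun g : ι → ℝ => u ⬝ᵥ g := by
  unfold dotProduct
  fun_prop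

section WeightedChiSquare

variable {ι : Type*} [Fintype ι] (b : OrthonormalBasis ι ℝ (EuclideanSpace ℝ ι)) {w : ι → ℝ}

lemma measurable_sum_mul_dotProduct_sq (w : ι → ℝ) :
    Measurable fun g : ι → ℝ => ∑ i, w i * ((b i).ofLp ⬝ᵥ g) ^ 2 := by
  have := fun i => measurable_dotProduct_left (b i).ofLp
  fun_prop

lemma mgf_sum_mul_dotProduct_sq (hw : ∀ i, 0 ≤ w i) (hw1 : ∑ i, w i = 1) {t : ℝ}
    (ht : |t| ≤ 1 / 12) :
    Integrable (fun g => Real.exp (t * ∑ i, w i * ((b i).ofLp ⬝ᵥ g) ^ 2))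
      (Measure.pi fun _ : ι => gaussianReal 0 1) ∧
    mgf (fun g => ∑ i, w i * ((b i).ofLp ⬝ᵥ g) ^ 2) (Measure.pi fun _ : ι => gaussianReal 0 1) t ≤
      Real.exp (t + 2 * t ^ 2) := by
  have ht' : t < 1 / 2 := by linarith [le_abs_self t]
  have hle : ∀ g : ι → ℝ, Real.exp (t * ∑ i, w i * ((b i).ofLp ⬝ᵥ g) ^ 2) ≤
      ∑ i, w i * Real.exp (t * ((b i).ofLp ⬝ᵥ g) ^ 2) := fun g => by
    have := convexOn_exp.map_sum_le (t := Finset.univ) (w := w)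
      (p := fun i => t * ((b i).ofLp ⬝ᵥ g) ^ 2) (fun i _ => hw i) hw1 (fun _ _ => Set.mem_univ _)
    simp only [smul_eq_mul] at this
    rw [Finset.mul_sum]
    exact (congrArg Real.exp (Finset.sum_congr rfl fun i _ => by ring)).trans_le this
  have hint : ∀ i, Integrable (fun g : ι → ℝ => Real.exp (t * ((b i).ofLp ⬝ᵥ g) ^ 2))
      (Measure.pi fun _ : ι => gaussianReal 0 1) := fun i => by
    have := integrable_exp_mul_sq_gaussianReal ht'
    rw [← map_pi_gaussianReal_inner b i] at this
    exact this.comp_measurable (measurable_dotProduct_left _)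
  have hsum : Integrable (fun g : ι → ℝ => ∑ i, w i * Real.exp (t * ((b i).ofLp ⬝ᵥ g) ^ 2))
      (Measure.pi fun _ : ι => gaussianReal 0 1) :=
    integrable_finsetSum _ fun i _ => (hint i).const_mul _
  have hI : Integrable (fun g => Real.exp (t * ∑ i, w i * ((b i).ofLp ⬝ᵥ g) ^ 2))
      (Measure.pi fun _ : ι => gaussianReal 0 1) := by
    refine hsum.mono' ?_ (ae_of_all _ fun g => ?_)
    · exact (((measurable_sum_mul_dotProduct_sq b w).const_mul t).exp).aestronglyMeasurable
    · rw [Real.norm_eq_abs, abs_of_pos (Real.exp_pos _)]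
      exact hle g
  refine ⟨hI, (integral_mono hI hsum hle).trans ?_⟩
  rw [integral_finsetSum _ fun i _ => (hint i).const_mul _]
  calc ∑ i, ∫ g, w i * Real.exp (t * ((b i).ofLp ⬝ᵥ g) ^ 2)
        ∂(Measure.pi fun _ : ι => gaussianReal 0 1)
      ≤ ∑ i, w i * Real.exp (t + 2 * t ^ 2) := Finset.sum_le_sum fun i _ => by
        rw [integral_const_mul, ← integral_map (φ := fun g : ι → ℝ => (b i).ofLp ⬝ᵥ g)
          (f := fun x : ℝ => Real.exp (t * x ^ 2)) (measurable_dotProduct_left _).aemeasurable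
          (Measurable.aestronglyMeasurable (by fun_prop)), map_pi_gaussianReal_inner]
        exact mul_le_mul_of_nonneg_left (integral_exp_mul_sq_gaussianReal_le ht) (hw i)
    _ = Real.exp (t + 2 * t ^ 2) := by rw [← Finset.sum_mul, hw1, one_mul]

end WeightedChiSquare

section Concentration

variable {n : ℕ} (b : OrthonormalBasis (Fin n) ℝ (EuclideanSpace ℝ (Fin n))) {w : Fin n → ℝ}

instance isProbabilityMeasure_gaussianVecs (s n : ℕ) :
    IsProbabilityMeasure (gaussianVecs s n) := by
  unfold gaussianVecs; infer_instance

lemma mgf_gaussianVecs_le (hw : ∀ i, 0 ≤ w i) (hw1 : ∑ i, w i = 1) (s : ℕ) {t : ℝ}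
    (ht : |t| ≤ 1 / 12) :
    Integrable (fun g => Real.exp (t * ∑ j, ∑ i, w i * ((b i).ofLp ⬝ᵥ g j) ^ 2))
      (gaussianVecs s n) ∧
    mgf (fun g => ∑ j, ∑ i, w i * ((b i).ofLp ⬝ᵥ g j) ^ 2) (gaussianVecs s n) t ≤
      Real.exp (s * (t + 2 * t ^ 2)) := by
  obtain ⟨hI, hM⟩ := mgf_sum_mul_dotProduct_sq b hw hw1 ht
  set X : (Fin n → ℝ) → ℝ := fun g => ∑ i, w i * ((b i).ofLp ⬝ᵥ g) ^ 2 with hX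
  have hXm : Measurable X := measurable_sum_mul_dotProduct_sq b w
  have hind : iIndepFun (fun (j : Fin s) (g : Fin s → Fin n → ℝ) => X (g j)) (gaussianVecs s n) :=
    iIndepFun_pi fun _ => hXm.aemeasurable
  have hmeas : ∀ j : Fin s, Measurable fun g : Fin s → Fin n → ℝ => X (g j) := fun j =>
    hXm.comp (measurable_pi_apply j)
  have hmp : ∀ j : Fin s, MeasurePreserving (fun g : Fin s → Fin n → ℝ => g j) (gaussianVecs s n)
      (Measure.pi fun _ => gaussianReal 0 1) := fun j =>
    measurePreserving_eval (fun _ : Fin s => Measure.pi fun _ : Fin n => gaussianReal 0 1) j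
  have hint : ∀ j : Fin s, Integrable (fun g => Real.exp (t * X (g j))) (gaussianVecs s n) :=
    fun j => (hmp j).integrable_comp_of_integrable hI
  have hmgf : ∀ j : Fin s, mgf (fun g => X (g j)) (gaussianVecs s n) t ≤
      Real.exp (t + 2 * t ^ 2) := fun j => by
    refine le_trans (le_of_eq ?_) hM
    rw [mgf, mgf, ← (hmp j).map_eq, integral_map (hmp j).measurable.aemeasurable
      (by rw [(hmp j).map_eq]; exact hI.aestronglyMeasurable)]
  have hfun : (fun g : Fin s → Fin n → ℝ => ∑ j, X (g j)) = ∑ j, fun g => X (g j) := by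
    ext g; simp
  constructor
  · have := hind.integrable_exp_mul_sum hmeas (s := Finset.univ) fun j _ => hint j
    rwa [← hfun] at this
  · rw [hfun, hind.mgf_sum hmeas]
    refine (Finset.prod_le_prod (fun j _ => mgf_nonneg) fun j _ => hmgf j).trans_eq ?_
    rw [Finset.prod_const, Finset.card_univ, Fintype.card_fin, Real.exp_nat_mul]

lemma gaussianVecs_abs_sub_ge_le (hw : ∀ i, 0 ≤ w i) (hw1 : ∑ i, w i = 1) (s : ℕ) {ε : ℝ}
    (hε : 0 ≤ ε) (hε' : ε ≤ 1 / 3) :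
    (gaussianVecs s n).real {g | s * ε ≤ |∑ j, ∑ i, w i * ((b i).ofLp ⬝ᵥ g j) ^ 2 - s|} ≤
      2 * Real.exp (-(s * ε ^ 2 / 8)) := by
  set Y : (Fin s → Fin n → ℝ) → ℝ := fun g => ∑ j, ∑ i, w i * ((b i).ofLp ⬝ᵥ g j) ^ 2
  obtain ⟨hI, hM⟩ := mgf_gaussianVecs_le b hw hw1 s (t := ε / 4)
    (by rw [abs_of_nonneg (by positivity)]; linarith)
  obtain ⟨hI', hM'⟩ := mgf_gaussianVecs_le b hw hw1 s (t := -(ε / 4))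
    (by rw [abs_neg, abs_of_nonneg (by positivity)]; linarith)
  have h1 := (measure_ge_le_exp_mul_mgf (X := Y) (s * (1 + ε)) (by positivity) hI).trans
    (mul_le_mul_of_nonneg_left hM (Real.exp_pos _).le)
  have h2 := (measure_le_le_exp_mul_mgf (X := Y) (s * (1 - ε)) (by linarith) hI').trans
    (mul_le_mul_of_nonneg_left hM' (Real.exp_pos _).le)
  rw [← Real.exp_add] at h1 h2
  have hsub : {g | s * ε ≤ |Y g - s|} ⊆ {g | s * (1 + ε) ≤ Y g} ∪ {g | Y g ≤ s * (1 - ε)} := by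
    intro g hg
    rcases le_abs.1 (show s * ε ≤ |Y g - s| from hg) with h | h
    · exact Or.inl (by change s * (1 + ε) ≤ Y g; linarith)
    · exact Or.inr (by change Y g ≤ s * (1 - ε); linarith)
  refine (measureReal_mono hsub).trans ((measureReal_union_le _ _).trans ?_)
  rw [two_mul]
  refine add_le_add (h1.trans_eq ?_) (h2.trans_eq ?_) <;> congr 1 <;> ring

end Concentration

lemma aeval_mulVec_of_mulVec_eq_smul {ι : Type*} [Fintype ι] [DecidableEq ι] {G : Matrix ι ι ℝ}
    {v : ι → ℝ} {μ : ℝ} (h : G *ᵥ v = μ • v) (p : Polynomial ℝ) :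
    (Polynomial.aeval G p) *ᵥ v = p.eval μ • v := by
  induction p using Polynomial.induction_on' with
  | add p q hp hq => rw [map_add, add_mulVec, hp, hq, Polynomial.eval_add, add_smul]
  | monomial k a =>
    have : ∀ k : ℕ, (G ^ k) *ᵥ v = μ ^ k • v := fun k => by
      induction k with
      | zero => simp
      | succ k ih => rw [pow_succ, ← mulVec_mulVec, h, mulVec_smul, ih, smul_smul, pow_succ']
    rw [Polynomial.aeval_monomial, Algebra.algebraMap_eq_smul_one, smul_mul_assoc, one_mul,
      smul_mulVec, this, Polynomial.eval_monomial, smul_smul]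

lemma dotProduct_aeval_mulVec {ι : Type*} [Fintype ι] [DecidableEq ι] {G : Matrix ι ι ℝ}
    (hG : G.IsHermitian) (p : Polynomial ℝ) (g : ι → ℝ) :
    g ⬝ᵥ (Polynomial.aeval G p) *ᵥ g =
      ∑ i, p.eval (hG.eigenvalues i) * ((hG.eigenvectorBasis i).ofLp ⬝ᵥ g) ^ 2 := by
  have hg : g = ∑ i, ((hG.eigenvectorBasis i).ofLp ⬝ᵥ g) • (hG.eigenvectorBasis i).ofLp := by
    have := congrArg WithLp.ofLp (hG.eigenvectorBasis.sum_repr' (WithLp.toLp 2 g))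
    simpa [EuclideanSpace.inner_eq_star_dotProduct, dotProduct_comm] using this.symm
  conv_lhs => enter [2, 2]; rw [hg]
  rw [mulVec_sum, dotProduct_sum]
  refine Finset.sum_congr rfl fun i _ => ?_
  rw [mulVec_smul, aeval_mulVec_of_mulVec_eq_smul (hG.mulVec_eigenvectorBasis i), dotProduct_smul,
    dotProduct_smul, dotProduct_comm g]
  simp only [smul_eq_mul]
  ring

lemma chebApproxMatrix_eq_aeval {n : ℕ} (α L : ℝ) (m : ℕ) (G : Matrix (Fin n) (Fin n) ℝ) :
    chebApproxMatrix α L m G = Polynomial.aeval G (chebApproxPoly α L m) := by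
  simp only [chebApproxMatrix, chebApproxPoly, map_add, map_sum, map_mul, Polynomial.aeval_C,
    Polynomial.aeval_comp, map_sub, Polynomial.aeval_X, map_one, Algebra.algebraMap_eq_smul_one,
    smul_mul_assoc, one_mul]

lemma abs_sub_logb_le {c S E ε : ℝ} (hε : 0 < ε) (hε' : ε < 1 / 3) (hS : 0 < S)
    (h1 : (1 - ε) ^ 2 * S ≤ E) (h2 : E ≤ (1 + ε) ^ 2 * S) :
    |c * Real.logb 2 S - c * Real.logb 2 E| ≤ |c * Real.logb 2 (1 - 3 * ε)| := by
  have hE : 0 < E := lt_of_lt_of_le (mul_pos (pow_pos (by linarith) 2) hS) h1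
  have hpos : 0 < 1 - 3 * ε := by linarith
  have hlow : (1 - 3 * ε) * S ≤ E := le_trans (by gcongr; nlinarith) h1
  have hup : (1 - 3 * ε) * E ≤ S := by
    have h3 : (1 - 3 * ε) * (1 + ε) ^ 2 ≤ 1 := by nlinarith [pow_pos hε 2, pow_pos hε 3]
    nlinarith [mul_le_mul_of_nonneg_left h2 hpos.le, mul_le_mul_of_nonneg_right h3 hS.le]
  have l1 := (Real.logb_le_logb one_lt_two (mul_pos hpos hS) hE).2 hlow
  have l2 := (Real.logb_le_logb one_lt_two (mul_pos hpos hE) hS).2 hup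
  rw [Real.logb_mul hpos.ne' hS.ne'] at l1
  rw [Real.logb_mul hpos.ne' hE.ne'] at l2
  rw [← mul_sub, abs_mul, abs_mul]
  refine mul_le_mul_of_nonneg_left ?_ (abs_nonneg c)
  exact (abs_le.2 ⟨by linarith, by linarith⟩).trans (neg_le_abs _)

/-- Chebyshev estimator for fractional-order matrix-based Rényi entropy,
full-rank case, with `m ≥ α + √κ·(Γ(α+1/2)·Γ(α)/(ε·π^{3/2}))^{1/(2α)}`. -/
theorem stmt10 {n : ℕ} (G : Matrix (Fin n) (Fin n) ℝ) (hG : G.PosDef)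
    (lmin lmax κ : ℝ)
    (hlmin : lmin = ⨅ i, hG.isHermitian.eigenvalues i) (hlminpos : 0 < lmin)
    (hlmax : lmax = ⨆ i, hG.isHermitian.eigenvalues i)
    (hκ : κ = lmax / lmin)
    (α : ℝ) (hα : 0 < α) (hαni : ∀ k : ℕ, α ≠ k) (hα1 : α ≠ 1)
    (ε δ : ℝ) (hε : ε ∈ Set.Ioo (0 : ℝ) (1 / 3)) (hδ : δ ∈ Set.Ioo (0 : ℝ) 1)
    (s : ℕ) (hs : s = ⌈8 * Real.log (2 / δ) / ε ^ 2⌉₊)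
    (m : ℕ)
    (hm : α + Real.sqrt κ *
        (Real.Gamma (α + 1 / 2) * Real.Gamma α / (ε * Real.pi ^ ((3 : ℝ) / 2))) ^ (1 / (2 * α))
        ≤ (m : ℝ)) :
    1 - ENNReal.ofReal δ ≤
      gaussianVecs s n
        {g | |(1 / (1 - α)) * Real.logb 2 (∑ i, hG.isHermitian.eigenvalues i ^ α)
              - (1 / (1 - α)) * Real.logb 2
                  ((1 / (s : ℝ)) * ∑ i, g i ⬝ᵥ (chebApproxMatrix α lmax m G).mulVec (g i))|
            ≤ |(1 / (1 - α)) * Real.logb 2 (1 - 3 * ε)|} := by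
  have hn : Nonempty (Fin n) := by
    by_contra h
    rw [not_nonempty_iff] at h
    rw [Real.iInf_of_isEmpty] at hlmin
    linarith
  obtain ⟨hε0, hε1⟩ := hε
  obtain ⟨hδ0, hδ1⟩ := hδ
  set ev := hG.isHermitian.eigenvalues
  set p := chebApproxPoly α lmax m
  have hev : ∀ i, ev i ∈ Set.Icc lmin lmax := fun i =>
    ⟨hlmin ▸ ciInf_le (Set.finite_range ev).bddBelow i,
      hlmax ▸ le_ciSup (Set.finite_range ev).bddAbove i⟩
  have hevpos : ∀ i, 0 < ev i ^ α := fun i =>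
    Real.rpow_pos_of_pos (hlminpos.trans_le (hev i).1) α
  have happ : ∀ i, |ev i ^ α - p.eval (ev i)| ≤ ε * ev i ^ α := fun i =>
    abs_rpow_sub_eval_chebApproxPoly_le_of_degree hlminpos hκ hα hαni hε0 hm (hev i)
  have hplow : ∀ i, (1 - ε) * ev i ^ α ≤ p.eval (ev i) := fun i => by
    linarith [(abs_le.1 (happ i)).2]
  have hpup : ∀ i, p.eval (ev i) ≤ (1 + ε) * ev i ^ α := fun i => by
    linarith [(abs_le.1 (happ i)).1]
  have hppos : ∀ i, 0 < p.eval (ev i) := fun i =>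
    (mul_pos (by linarith) (hevpos i)).trans_le (hplow i)
  set S := ∑ i, ev i ^ α
  set W := ∑ i, p.eval (ev i)
  have hS : 0 < S := Finset.sum_pos (fun i _ => hevpos i) Finset.univ_nonempty
  have hW0 : 0 < W := Finset.sum_pos (fun i _ => hppos i) Finset.univ_nonempty
  have hWlow : (1 - ε) * S ≤ W := by
    rw [Finset.mul_sum]; exact Finset.sum_le_sum fun i _ => hplow i
  have hWup : W ≤ (1 + ε) * S := by
    rw [Finset.mul_sum]; exact Finset.sum_le_sum fun i _ => hpup i
  have hlog : 0 < Real.log (2 / δ) := Real.log_pos ((one_lt_div hδ0).2 (by linarith))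
  have hsle : 8 * Real.log (2 / δ) / ε ^ 2 ≤ s := hs ▸ Nat.le_ceil _
  have hs0 : (0 : ℝ) < s := lt_of_lt_of_le (by positivity) hsle
  have hconc := gaussianVecs_abs_sub_ge_le hG.isHermitian.eigenvectorBasis
    (w := fun i => p.eval (ev i) / W) (fun i => (div_pos (hppos i) hW0).le)
    (by rw [← Finset.sum_div, div_self hW0.ne']) s hε0.le hε1.le
  have hexp : 2 * Real.exp (-(s * ε ^ 2 / 8)) ≤ δ := by
    rw [div_le_iff₀ (by positivity)] at hsle
    have : Real.exp (-(s * ε ^ 2 / 8)) ≤ Real.exp (-Real.log (2 / δ)) :=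
      Real.exp_le_exp.2 (by linarith)
    rw [Real.exp_neg (Real.log _), Real.exp_log (by positivity), inv_div] at this
    linarith
  set B : Set (Fin s → Fin n → ℝ) := {g | s * ε ≤ |∑ j, ∑ i, p.eval (ev i) / W *
    ((hG.isHermitian.eigenvectorBasis i).ofLp ⬝ᵥ g j) ^ 2 - s|}
  have hB : gaussianVecs s n B ≤ ENNReal.ofReal δ := by
    rw [← ofReal_measureReal]
    exact ENNReal.ofReal_le_ofReal (hconc.trans hexp)
  have hcompl : 1 - ENNReal.ofReal δ ≤ gaussianVecs s n Bᶜ := by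
    rw [tsub_le_iff_right, ← measure_univ (μ := gaussianVecs s n), ← Set.compl_union_self B]
    exact (measure_union_le _ _).trans (add_le_add_right hB _)
  refine hcompl.trans (measure_mono fun g hg => ?_)
  have hg' := abs_lt.1 (not_le.1 (show ¬ s * ε ≤ |_ - (s : ℝ)| from hg))
  have hest : 1 / (s : ℝ) * ∑ j, g j ⬝ᵥ (chebApproxMatrix α lmax m G).mulVec (g j) =
      W * ((∑ j, ∑ i, p.eval (ev i) / W *
        ((hG.isHermitian.eigenvectorBasis i).ofLp ⬝ᵥ g j) ^ 2) / s) := by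
    rw [mul_div_assoc', one_div, inv_mul_eq_div, Finset.mul_sum]
    congr 1
    refine Finset.sum_congr rfl fun j _ => ?_
    rw [chebApproxMatrix_eq_aeval, dotProduct_aeval_mulVec hG.isHermitian, Finset.mul_sum]
    refine Finset.sum_congr rfl fun i _ => ?_
    field_simp
    exact mul_comm _ _
  rw [Set.mem_ofPred_eq, hest]
  set y := ∑ j, ∑ i, p.eval (ev i) / W *
    ((hG.isHermitian.eigenvectorBasis i).ofLp ⬝ᵥ g j) ^ 2
  have hy1 : 1 - ε ≤ y / s := by rw [le_div_iff₀ hs0]; linarith [hg'.1]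
  have hy2 : y / s ≤ 1 + ε := by rw [div_le_iff₀ hs0]; linarith [hg'.2]
  refine abs_sub_logb_le hε0 hε1 hS ?_ ?_
  · calc (1 - ε) ^ 2 * S = (1 - ε) * S * (1 - ε) := by ring
      _ ≤ W * (y / s) := mul_le_mul hWlow hy1 (by linarith) hW0.le
  · calc W * (y / s) ≤ (1 + ε) * S * (1 + ε) := mul_le_mul hWup hy2 (by linarith) (by positivity)
      _ = (1 + ε) ^ 2 * S := by ring
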